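/- arXiv:2205.08800 — 2 statements merged into one kernel-verified Lean document; each statement's English description precedes it below -/
import Mathlib

section
/- Fix N ≥ 2, a link pattern β ∈ LP_N, and j ∈ {1,…,2N−1} such that {j,j+1} ∉ β. Fix points x_1 < ⋯ < x_{j−1} < x_{j+2} < ⋯ < x_{2N} and ξ ∈ (x_{j−1}, x_{j+2}) (with the conventions x_0 = −∞, x_{2N+1} = +∞). Then, in the limit as x_j and x_{j+1} both tend to ξ subject to x_{j−1} < x_j < x_{j+1} < x_{j+2}, one has F_β(x_1,…,x_{2N}) / (x_{j+1}−x_j)^{−1/8} → F_{℘_j(β)/{j,j+1}}(ẍ_j). -/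
open Filter Topology

noncomputable section

/-- The cross-ratio `χ(y₁,y₂,y₃,y₄)` of four reals. -/
def crossRatioR (y₁ y₂ y₃ y₄ : ℝ) : ℝ :=
  (|y₂ - y₁| * |y₄ - y₃|) / (|y₃ - y₁| * |y₄ - y₂|)

/-- The sign `±1` associated to a boolean. -/
def sgn (s : Bool) : ℝ := if s then 1 else -1

/-- `a b : Fin N → Fin (2*N)` encode a planar link pattern `β ∈ LP_N`:
the pairs (links) `{a r, b r}` partition `{0, …, 2N-1}`, the link endpoints
are ordered so that `a` is strictly increasing and `a r < b r` for every link,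
and the links are non-crossing. -/
def IsLinkPattern (N : ℕ) (a b : Fin N → Fin (2 * N)) : Prop :=
  Function.Bijective (fun p : Fin N × Bool => if p.2 then a p.1 else b p.1) ∧
    StrictMono a ∧ (∀ r, a r < b r) ∧
    ¬∃ r s : Fin N, a r < a s ∧ a s < b r ∧ b r < b s

/-- The function `F_β` associated to the link pattern `β` encoded by `a, b`. -/
def Fbeta (N : ℕ) (a b : Fin N → Fin (2 * N)) (x : Fin (2 * N) → ℝ) : ℝ :=
  (∏ r : Fin N, |x (b r) - x (a r)| ^ (-(1 / 8) : ℝ)) *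
    (∑ σ : Fin N → Bool, ∏ s : Fin N, ∏ t : Fin N,
        if s < t then
          crossRatioR (x (a s)) (x (a t)) (x (b t)) (x (b s)) ^ (sgn (σ s) * sgn (σ t) / 4)
        else 1) ^ ((1 : ℝ) / 2)

/-- The chamber `𝔛_n = {x ∈ ℝⁿ : x₀ < x₁ < ⋯ < x_{n-1}}`. -/
def chamber (n : ℕ) : Set (Fin n → ℝ) := {x | StrictMono x}

/-- The order-preserving embedding of `{0,…,2N-3}` into `{0,…,2N-1}` skipping the
positions `j` and `j+1`; it realizes the relabeling used in `β/{j,j+1}` and `ẍ_j`. -/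
def skipTwo {N : ℕ} (j : Fin (2 * N)) (i : Fin (2 * (N - 1))) : Fin (2 * N) :=
  if h : i.val < j.val then ⟨i.val, lt_trans h j.isLt⟩
  else ⟨i.val + 2, by have := i.isLt; omega⟩

lemma crossRatioR_nonneg (p u v q : ℝ) : 0 ≤ crossRatioR p u v q := by
  unfold crossRatioR; positivity

lemma crossRatioR_swap_outer (p u v q : ℝ) : crossRatioR q u v p = (crossRatioR p u v q)⁻¹ := by
  unfold crossRatioR
  rw [inv_div, abs_sub_comm u q, abs_sub_comm p v, abs_sub_comm v q, abs_sub_comm p u,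
    mul_comm, mul_comm |q - v|]

lemma crossRatioR_swap_inner (p u v q : ℝ) : crossRatioR p v u q = (crossRatioR p u v q)⁻¹ := by
  unfold crossRatioR
  rw [inv_div]

lemma crossRatioR_symm (p u v q : ℝ) : crossRatioR u p q v = crossRatioR p u v q := by
  unfold crossRatioR
  rw [abs_sub_comm p u, abs_sub_comm v q, abs_sub_comm q u, abs_sub_comm v p, mul_comm |u - q|]

lemma sgn_xor (s t : Bool) : sgn (xor s t) = if t then -sgn s else sgn s := by
  cases s <;> cases t <;> simp [sgn]

/-- The interaction weight of the spin configuration `σ` on a family of oriented links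
`(p i, q i)`, with each unordered pair of links counted twice at half strength. -/
def linkWeight {ι : Type*} [Fintype ι] [DecidableEq ι] (p q : ι → ℝ) (σ : ι → Bool) : ℝ :=
  ∏ s : ι, ∏ t : ι, if s = t then 1 else
    crossRatioR (p s) (p t) (q t) (q s) ^ (sgn (σ s) * sgn (σ t) / 8)

/-- The function `F` of an arbitrarily indexed family of oriented links `(p i, q i)`. -/
def linkFun {ι : Type*} [Fintype ι] [DecidableEq ι] (p q : ι → ℝ) : ℝ :=
  (∏ r : ι, |q r - p r| ^ (-(1 / 8) : ℝ)) * (∑ σ : ι → Bool, linkWeight p q σ) ^ ((1 : ℝ) / 2)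

lemma linkWeight_nonneg {ι : Type*} [Fintype ι] [DecidableEq ι] (p q : ι → ℝ) (σ : ι → Bool) :
    0 ≤ linkWeight p q σ := by
  refine Finset.prod_nonneg fun s _ => Finset.prod_nonneg fun t _ => ?_
  split_ifs
  · exact zero_le_one
  · exact Real.rpow_nonneg (crossRatioR_nonneg _ _ _ _) _

lemma rpow_div_eight_mul_self {y : ℝ} (hy : 0 ≤ y) (a b : ℝ) :
    y ^ (a * b / 8) * y ^ (b * a / 8) = y ^ (a * b / 4) := by
  rw [mul_comm b a, ← sq, ← Real.rpow_mul_natCast hy]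
  congr 1
  push_cast
  ring

lemma prod_lt_eq_linkWeight {ι : Type*} [Fintype ι] [LinearOrder ι] (p q : ι → ℝ)
    (σ : ι → Bool) :
    (∏ s : ι, ∏ t : ι, if s < t then
      crossRatioR (p s) (p t) (q t) (q s) ^ (sgn (σ s) * sgn (σ t) / 4) else 1)
      = linkWeight p q σ := by
  have h₁ : linkWeight p q σ = (∏ s : ι, ∏ t : ι, if s < t then
      crossRatioR (p s) (p t) (q t) (q s) ^ (sgn (σ s) * sgn (σ t) / 8) else 1) *
      (∏ s : ι, ∏ t : ι, if t < s then
      crossRatioR (p s) (p t) (q t) (q s) ^ (sgn (σ s) * sgn (σ t) / 8) else 1) := by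
    unfold linkWeight
    simp only [← Finset.prod_mul_distrib]
    refine Finset.prod_congr rfl fun s _ => Finset.prod_congr rfl fun t _ => ?_
    rcases lt_trichotomy s t with h | h | h
    · simp [h, h.ne, h.not_gt]
    · simp [h]
    · simp [h, h.ne', h.not_gt]
  rw [h₁, Finset.prod_comm (f := fun s t => if t < s then _ else _)]
  simp only [← Finset.prod_mul_distrib]
  refine Finset.prod_congr rfl fun s _ => Finset.prod_congr rfl fun t _ => ?_
  split_ifs
  · rw [crossRatioR_symm (p s) (p t), rpow_div_eight_mul_self (crossRatioR_nonneg _ _ _ _)]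
  · simp

lemma Fbeta_eq_linkFun (N : ℕ) (a b : Fin N → Fin (2 * N)) (x : Fin (2 * N) → ℝ) :
    Fbeta N a b x = linkFun (fun r => x (a r)) (fun r => x (b r)) := by
  unfold Fbeta linkFun
  congr 2
  exact Finset.sum_congr rfl fun σ _ =>
    prod_lt_eq_linkWeight (fun r => x (a r)) (fun r => x (b r)) σ

lemma linkFun_comp_equiv {ι κ : Type*} [Fintype ι] [DecidableEq ι] [Fintype κ] [DecidableEq κ]
    (e : ι ≃ κ) (p q : κ → ℝ) :
    linkFun (fun i => p (e i)) (fun i => q (e i)) = linkFun p q := by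
  unfold linkFun
  congr 1
  · exact Equiv.prod_comp e fun r => |q r - p r| ^ (-(1 / 8) : ℝ)
  · congr 1
    refine Fintype.sum_equiv (e.arrowCongr (Equiv.refl Bool)) _ _ fun σ => ?_
    unfold linkWeight
    refine Fintype.prod_equiv e _ _ fun s => Fintype.prod_equiv e _ _ fun t => ?_
    simp

lemma linkFun_flip {ι : Type*} [Fintype ι] [DecidableEq ι] (p q : ι → ℝ) (f : ι → Bool) :
    linkFun (fun i => if f i then q i else p i) (fun i => if f i then p i else q i)
      = linkFun p q := by
  unfold linkFun
  congr 1
  · refine Finset.prod_congr rfl fun r _ => ?_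
    by_cases h : f r
    · simp only [h, if_true]
      rw [abs_sub_comm]
    · simp only [h]
      rfl
  · congr 1
    have hinv : Function.Involutive fun (σ : ι → Bool) i => xor (σ i) (f i) := by
      intro σ; funext i; simp
    refine Fintype.sum_equiv hinv.toPerm _ _ fun σ => ?_
    unfold linkWeight
    refine Finset.prod_congr rfl fun s _ => Finset.prod_congr rfl fun t _ => ?_
    split_ifs with h
    · rfl
    · have hX := crossRatioR_nonneg (p s) (p t) (q t) (q s)
      simp only [Function.Involutive.coe_toPerm, sgn_xor]
      cases f s <;> cases f t <;>
        simp [crossRatioR_swap_outer (p s), crossRatioR_swap_inner (p s) (p t), neg_div,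
          Real.rpow_neg, Real.inv_rpow, hX]

lemma linkFun_eq_of_equiv {ι κ : Type*} [Fintype ι] [DecidableEq ι] [Fintype κ] [DecidableEq κ]
    (e : ι ≃ κ) (p q : ι → ℝ) (p' q' : κ → ℝ)
    (h : ∀ i, (p i = p' (e i) ∧ q i = q' (e i)) ∨ (p i = q' (e i) ∧ q i = p' (e i))) :
    linkFun p q = linkFun p' q' := by
  classical
  rw [← linkFun_comp_equiv e p' q', ← linkFun_flip (fun i => p' (e i)) (fun i => q' (e i))
    fun i => decide ¬(p i = p' (e i) ∧ q i = q' (e i))]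
  congr 1 <;> funext i <;> have := h i <;> by_cases h' : p i = p' (e i) ∧ q i = q' (e i) <;>
    simp_all

lemma linkWeight_option {κ : Type*} [Fintype κ] [DecidableEq κ] (p q : Option κ → ℝ)
    (σ : Option κ → Bool) :
    linkWeight p q σ = (∏ u : κ, crossRatioR (p none) (p (some u)) (q (some u)) (q none)
        ^ (sgn (σ none) * sgn (σ (some u)) / 4)) *
      linkWeight (fun u => p (some u)) (fun u => q (some u)) (fun u => σ (some u)) := by
  unfold linkWeight
  simp only [Fintype.prod_option, Finset.prod_mul_distrib, if_true, reduceCtorEq, if_false,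
    one_mul, Option.some_inj]
  rw [← mul_assoc, ← Finset.prod_mul_distrib]
  congr 1
  refine Finset.prod_congr rfl fun u _ => ?_
  rw [crossRatioR_symm (p none), mul_comm,
    rpow_div_eight_mul_self (crossRatioR_nonneg _ _ _ _)]

lemma sum_option_arrow_bool {κ : Type*} [Fintype κ] [DecidableEq κ] (f : (Option κ → Bool) → ℝ) :
    ∑ σ, f σ = ∑ s : Bool, ∑ τ : κ → Bool, f (fun o => o.elim s τ) := by
  rw [← Fintype.sum_prod_type']
  refine Fintype.sum_equiv (Equiv.piOptionEquivProd (β := fun _ => Bool)) _ _ fun σ => ?_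
  congr 1
  funext o
  cases o <;> rfl

lemma sgn_mul_self (s : Bool) : sgn s * sgn s = 1 := by cases s <;> simp [sgn]

lemma sgn_mul_of_ne {s t : Bool} (h : s ≠ t) : sgn s * sgn t = -1 := by
  cases s <;> cases t <;> simp_all [sgn]

lemma crossRatioR_mul_of_shared {k₁ k₂ ξ c d : ℝ} (hc : c ≠ ξ) (hd : d ≠ ξ) :
    crossRatioR k₁ c d ξ * crossRatioR ξ c d k₂ = crossRatioR k₁ c d k₂ := by
  unfold crossRatioR
  have h₁ : |c - ξ| ≠ 0 := abs_ne_zero.2 (sub_ne_zero.2 hc)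
  have h₂ : |d - ξ| ≠ 0 := abs_ne_zero.2 (sub_ne_zero.2 hd)
  rw [abs_sub_comm ξ c, abs_sub_comm ξ d, div_mul_div_comm]
  calc _ = (|c - ξ| * |d - ξ|) * (|c - k₁| * |k₂ - d|) /
        ((|c - ξ| * |d - ξ|) * (|d - k₁| * |k₂ - c|)) := by ring_nf
    _ = _ := mul_div_mul_left _ _ (mul_ne_zero h₁ h₂)

/-- Points `p` of the plane with `p.1 < p.2`, approaching the diagonal point `(ξ, ξ)`. -/
def orderedNhds (ξ : ℝ) : Filter (ℝ × ℝ) := 𝓝[{p : ℝ × ℝ | p.1 < p.2}] (ξ, ξ)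

lemma tendsto_pair_factor {k₁ k₂ ξ : ℝ} (h₁ : k₁ ≠ ξ) (h₂ : k₂ ≠ ξ) (h₁₂ : k₁ ≠ k₂)
    (s t : Bool) :
    Tendsto (fun p : ℝ × ℝ => |p.1 - k₁| ^ (-(1 / 4) : ℝ) * |k₂ - p.2| ^ (-(1 / 4) : ℝ) *
        (p.2 - p.1) ^ (1 / 4 : ℝ) * crossRatioR k₁ p.2 k₂ p.1 ^ (sgn s * sgn t / 4))
      (orderedNhds ξ) (𝓝 (if s = t then |k₂ - k₁| ^ (-(1 / 4) : ℝ) else 0)) := by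
  have e₁ : |ξ - k₁| ≠ 0 := abs_ne_zero.2 (sub_ne_zero.2 h₁.symm)
  have e₂ : |k₂ - ξ| ≠ 0 := abs_ne_zero.2 (sub_ne_zero.2 h₂)
  have e₂' : |ξ - k₂| ≠ 0 := abs_ne_zero.2 (sub_ne_zero.2 h₂.symm)
  have e₁₂ : 0 < |k₂ - k₁| := abs_pos.2 (sub_ne_zero.2 h₁₂.symm)
  have c₁ : ContinuousAt (fun p : ℝ × ℝ => |p.1 - k₁| ^ (-(1 / 4) : ℝ)) (ξ, ξ) :=
    ContinuousAt.rpow_const (by fun_prop) (Or.inl e₁)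
  have c₂ : ContinuousAt (fun p : ℝ × ℝ => |k₂ - p.2| ^ (-(1 / 4) : ℝ)) (ξ, ξ) :=
    ContinuousAt.rpow_const (by fun_prop) (Or.inl e₂)
  by_cases hst : s = t
  · subst hst
    have c₃ : ContinuousAt (fun p : ℝ × ℝ =>
        (|p.2 - k₁| * |p.1 - k₂| / |k₂ - k₁|) ^ (1 / 4 : ℝ)) (ξ, ξ) :=
      ContinuousAt.rpow_const (by fun_prop) (Or.inr (by norm_num))
    have h := ((c₁.tendsto.mul c₂).mul c₃).mono_left
      (nhdsWithin_le_nhds (s := {p : ℝ × ℝ | p.1 < p.2}))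
    rw [if_pos rfl]
    have hlim : |ξ - k₁| ^ (-(1 / 4) : ℝ) * |k₂ - ξ| ^ (-(1 / 4) : ℝ) *
        (|ξ - k₁| * |ξ - k₂| / |k₂ - k₁|) ^ (1 / 4 : ℝ) = |k₂ - k₁| ^ (-(1 / 4) : ℝ) := by
      rw [Real.div_rpow (by positivity) (by positivity),
        Real.mul_rpow (by positivity) (by positivity), abs_sub_comm k₂ ξ,
        Real.rpow_neg (by positivity), Real.rpow_neg (by positivity),
        Real.rpow_neg (by positivity)]
      have := (Real.rpow_pos_of_pos (lt_of_le_of_ne (abs_nonneg _) e₁.symm) (1 / 4)).ne'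
      have := (Real.rpow_pos_of_pos (lt_of_le_of_ne (abs_nonneg _) e₂'.symm) (1 / 4)).ne'
      field_simp
    rw [← hlim]
    refine h.congr' ?_
    filter_upwards [self_mem_nhdsWithin] with p hp
    have hp' : 0 < p.2 - p.1 := sub_pos.2 hp
    rw [sgn_mul_self, mul_assoc _ ((p.2 - p.1) ^ _), ← Real.mul_rpow hp'.le
      (crossRatioR_nonneg _ _ _ _)]
    congr 2
    unfold crossRatioR
    rw [abs_sub_comm p.1 p.2, abs_of_pos hp']
    field_simp
  · have c₃ : ContinuousAt (fun p : ℝ × ℝ => (p.2 - p.1) ^ (1 / 4 : ℝ)) (ξ, ξ) :=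
      ContinuousAt.rpow_const (by fun_prop) (Or.inr (by norm_num))
    have c₄ : ContinuousAt (fun p : ℝ × ℝ =>
        crossRatioR k₁ k₂ p.2 p.1 ^ (1 / 4 : ℝ)) (ξ, ξ) := by
      refine ContinuousAt.rpow_const ?_ (Or.inr (by norm_num))
      unfold crossRatioR
      exact ContinuousAt.div (by fun_prop) (by fun_prop) (mul_ne_zero e₁ e₂')
    have h := (((c₁.tendsto.mul c₂).mul c₃).mul c₄).mono_left
      (nhdsWithin_le_nhds (s := {p : ℝ × ℝ | p.1 < p.2}))
    rw [if_neg hst]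
    convert h using 2 with p
    · rw [sgn_mul_of_ne hst, crossRatioR_swap_inner k₁ k₂ p.2 p.1, neg_div,
        Real.inv_rpow (crossRatioR_nonneg _ _ _ _), Real.rpow_neg (crossRatioR_nonneg _ _ _ _),
        inv_inv]
    · rfl
    · simp

/-- The family of endpoints obtained by adjoining `k` and `z` to `c`. -/
def consTwo {κ : Type*} (k z : ℝ) (c : κ → ℝ) (o : Option (Option κ)) : ℝ :=
  o.elim k fun o' => o'.elim z c

/-- The family of endpoints obtained by adjoining `k` to `c`. -/
def consOne {κ : Type*} (k : ℝ) (c : κ → ℝ) (o : Option κ) : ℝ := o.elim k c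

section Limit

variable {κ : Type*} [Fintype κ] [DecidableEq κ]

lemma tendsto_linkWeight_consTwo {k₁ k₂ ξ : ℝ} (h₁ : k₁ ≠ ξ) (h₂ : k₂ ≠ ξ) (h₁₂ : k₁ ≠ k₂)
    {c d : κ → ℝ} (hcξ : ∀ u, c u ≠ ξ) (hdξ : ∀ u, d u ≠ ξ)
    (hc₁ : ∀ u, c u ≠ k₁) (hd₁ : ∀ u, d u ≠ k₁) (hc₂ : ∀ u, c u ≠ k₂) (hd₂ : ∀ u, d u ≠ k₂)
    (s t : Bool) (τ : κ → Bool) :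
    Tendsto (fun p : ℝ × ℝ => |p.1 - k₁| ^ (-(1 / 4) : ℝ) * |k₂ - p.2| ^ (-(1 / 4) : ℝ) *
        (p.2 - p.1) ^ (1 / 4 : ℝ) * linkWeight (consTwo k₁ p.2 c) (consTwo p.1 k₂ d)
          (fun o => o.elim s fun o' => o'.elim t τ))
      (orderedNhds ξ)
      (𝓝 (if s = t then |k₂ - k₁| ^ (-(1 / 4) : ℝ) *
        linkWeight (consOne k₁ c) (consOne k₂ d) (fun o => o.elim s τ) else 0)) := by
  have hne {y z : ℝ} (h : y ≠ z) : |y - z| ≠ 0 := abs_ne_zero.2 (sub_ne_zero.2 h)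
  have cy : ContinuousAt (fun p : ℝ × ℝ =>
      ∏ u, crossRatioR k₁ (c u) (d u) p.1 ^ (sgn s * sgn (τ u) / 4)) (ξ, ξ) := by
    refine tendsto_finsetProd _ fun u _ => ?_
    refine ContinuousAt.rpow_const ?_ (Or.inl ?_) <;> unfold crossRatioR
    · exact ContinuousAt.div (by fun_prop) (by fun_prop)
        (mul_ne_zero (hne (hd₁ u)) (hne (hcξ u).symm))
    · exact div_ne_zero (mul_ne_zero (hne (hc₁ u)) (hne (hdξ u).symm))
        (mul_ne_zero (hne (hd₁ u)) (hne (hcξ u).symm))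
  have cz : ContinuousAt (fun p : ℝ × ℝ =>
      ∏ u, crossRatioR p.2 (c u) (d u) k₂ ^ (sgn t * sgn (τ u) / 4)) (ξ, ξ) := by
    refine tendsto_finsetProd _ fun u _ => ?_
    refine ContinuousAt.rpow_const ?_ (Or.inl ?_) <;> unfold crossRatioR
    · exact ContinuousAt.div (by fun_prop) (by fun_prop)
        (mul_ne_zero (hne (hdξ u)) (hne (hc₂ u).symm))
    · exact div_ne_zero (mul_ne_zero (hne (hcξ u)) (hne (hd₂ u).symm))
        (mul_ne_zero (hne (hdξ u)) (hne (hc₂ u).symm))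
  have h := (((tendsto_pair_factor h₁ h₂ h₁₂ s t).mul
    (cy.tendsto.mono_left nhdsWithin_le_nhds)).mul
    (cz.tendsto.mono_left nhdsWithin_le_nhds)).mul_const (linkWeight c d τ)
  convert h using 2
  · rw [linkWeight_option, linkWeight_option, Fintype.prod_option]
    simp only [consTwo, Option.elim]
    ring
  · split_ifs with hst
    · subst hst
      rw [linkWeight_option]
      simp only [consOne, Option.elim]
      rw [mul_assoc (_ ^ _), ← Finset.prod_mul_distrib, mul_assoc]
      congr 2
      refine Finset.prod_congr rfl fun u _ => ?_
      rw [← Real.mul_rpow (crossRatioR_nonneg _ _ _ _) (crossRatioR_nonneg _ _ _ _),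
        crossRatioR_mul_of_shared (hcξ u) (hdξ u)]
    · simp

lemma rpow_quarter_rpow_half {y : ℝ} (hy : 0 ≤ y) :
    (y ^ (-(1 / 4) : ℝ)) ^ (1 / 2 : ℝ) = y ^ (-(1 / 8) : ℝ) := by
  rw [← Real.rpow_mul hy]
  norm_num

lemma tendsto_linkFun_consTwo {k₁ k₂ ξ : ℝ} (h₁ : k₁ ≠ ξ) (h₂ : k₂ ≠ ξ) (h₁₂ : k₁ ≠ k₂)
    {c d : κ → ℝ} (hcξ : ∀ u, c u ≠ ξ) (hdξ : ∀ u, d u ≠ ξ)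
    (hc₁ : ∀ u, c u ≠ k₁) (hd₁ : ∀ u, d u ≠ k₁) (hc₂ : ∀ u, c u ≠ k₂) (hd₂ : ∀ u, d u ≠ k₂) :
    Tendsto (fun p : ℝ × ℝ => linkFun (consTwo k₁ p.2 c) (consTwo p.1 k₂ d) /
        (p.2 - p.1) ^ (-(1 / 8) : ℝ))
      (orderedNhds ξ) (𝓝 (linkFun (consOne k₁ c) (consOne k₂ d))) := by
  have hsum := tendsto_finsetSum Finset.univ fun (s : Bool) _ =>
    tendsto_finsetSum Finset.univ fun (t : Bool) _ =>
      tendsto_finsetSum Finset.univ fun (τ : κ → Bool) _ =>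
        tendsto_linkWeight_consTwo h₁ h₂ h₁₂ hcξ hdξ hc₁ hd₁ hc₂ hd₂ s t τ
  have h := (hsum.rpow_const (p := 1 / 2) (Or.inr (by norm_num))).const_mul
    (∏ u, |d u - c u| ^ (-(1 / 8) : ℝ))
  have hlim : (∑ s : Bool, ∑ t : Bool, ∑ τ : κ → Bool, if s = t then
      |k₂ - k₁| ^ (-(1 / 4) : ℝ) * linkWeight (consOne k₁ c) (consOne k₂ d)
        (fun o => o.elim s τ) else 0) =
      |k₂ - k₁| ^ (-(1 / 4) : ℝ) * ∑ σ, linkWeight (consOne k₁ c) (consOne k₂ d) σ := by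
    rw [sum_option_arrow_bool, Finset.mul_sum]
    refine Finset.sum_congr rfl fun s _ => ?_
    rw [Finset.sum_comm, Finset.mul_sum]
    simp
  rw [hlim, Real.mul_rpow (by positivity)
    (Finset.sum_nonneg fun _ _ => linkWeight_nonneg _ _ _),
    rpow_quarter_rpow_half (abs_nonneg _)] at h
  convert h.congr' ?_ using 2
  · unfold linkFun
    rw [Fintype.prod_option]
    simp only [consOne, Option.elim]
    ring
  · filter_upwards [self_mem_nhdsWithin] with p hp
    have hp' : 0 < p.2 - p.1 := sub_pos.2 hp
    simp only [← Finset.mul_sum]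
    rw [Real.mul_rpow (by positivity) (Finset.sum_nonneg fun _ _ => Finset.sum_nonneg fun _ _ =>
        Finset.sum_nonneg fun _ _ => linkWeight_nonneg _ _ _),
      Real.mul_rpow (by positivity) (by positivity),
      Real.mul_rpow (by positivity) (by positivity), rpow_quarter_rpow_half (abs_nonneg _),
      rpow_quarter_rpow_half (abs_nonneg _), ← Real.rpow_mul hp'.le]
    unfold linkFun
    rw [Fintype.prod_option, Fintype.prod_option, sum_option_arrow_bool]
    simp only [sum_option_arrow_bool, consTwo, Option.elim]
    rw [Real.rpow_neg hp'.le, div_inv_eq_mul, show (1 / 4 * (1 / 2) : ℝ) = 1 / 8 by norm_num]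
    ring

end Limit

lemma skipTwo_ne {N : ℕ} (j : Fin (2 * N)) (i : Fin (2 * (N - 1))) :
    (skipTwo j i).val ≠ j.val ∧ (skipTwo j i).val ≠ j.val + 1 := by
  unfold skipTwo
  split_ifs with h <;> dsimp only <;> omega

lemma skipTwo_injective {N : ℕ} (j : Fin (2 * N)) : Function.Injective (skipTwo j) := by
  intro i i' h
  have h' := congrArg Fin.val h
  unfold skipTwo at h'
  ext
  split_ifs at h' <;> dsimp only at h' <;> omega

lemma IsLinkPattern.endpoints {N : ℕ} {a b : Fin N → Fin (2 * N)} (h : IsLinkPattern N a b) :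
    Function.Injective a ∧ Function.Injective b ∧ ∀ s t, a s ≠ b t := by
  refine ⟨h.2.1.injective, fun s t hst => ?_, fun s t hst => ?_⟩
  · have := @h.1.1 (s, false) (t, false) (by simpa using hst)
    simpa using this
  · have := @h.1.1 (s, true) (t, false) (by simpa using hst)
    simp at this

/-- asymptotics of `F_β` as `x_j, x_{j+1} → ξ` when `{j, j+1} ∉ β`:
the renormalized value tends to `F_{℘_j(β)/{j,j+1}}(ẍ_j)`.
Here `k₁` (resp. `k₂`) is the pair of `j` (resp. `j+1`) in `β`, and `a'' b''` encode
the link pattern `℘_j(β)/{j,j+1}` (its links are the links of `β` not touching `j, j+1`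
together with `{k₁, k₂}`, relabeled via `skipTwo j`). -/
theorem Fbeta_asymptotics_tying (N : ℕ) (hN : 2 ≤ N) (a b : Fin N → Fin (2 * N))
    (hβ : IsLinkPattern N a b)
    (j : Fin (2 * N)) (hj : j.val + 1 < 2 * N)
    (hnot : ¬∃ r : Fin N, a r = j ∧ (b r).val = j.val + 1)
    (k₁ k₂ : Fin (2 * N))
    (hk₁ : ∃ s : Fin N, (a s = j ∧ b s = k₁) ∨ (a s = k₁ ∧ b s = j))
    (hk₂ : ∃ s : Fin N, (a s = ⟨j.val + 1, hj⟩ ∧ b s = k₂) ∨ (a s = k₂ ∧ b s = ⟨j.val + 1, hj⟩))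
    (x : Fin (2 * N) → ℝ) (ξ : ℝ)
    (hx : ∀ i i' : Fin (2 * N), i < i' →
      i.val ≠ j.val → i.val ≠ j.val + 1 → i'.val ≠ j.val → i'.val ≠ j.val + 1 → x i < x i')
    (hlo : ∀ i : Fin (2 * N), i.val < j.val → x i < ξ)
    (hhi : ∀ i : Fin (2 * N), j.val + 1 < i.val → ξ < x i)
    (a'' b'' : Fin (N - 1) → Fin (2 * (N - 1))) (hβ'' : IsLinkPattern (N - 1) a'' b'')
    (hcorr : ∀ r : Fin (N - 1),
      (∃ s : Fin N, skipTwo j (a'' r) = a s ∧ skipTwo j (b'' r) = b s)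
        ∨ (skipTwo j (a'' r) = k₁ ∧ skipTwo j (b'' r) = k₂)
        ∨ (skipTwo j (a'' r) = k₂ ∧ skipTwo j (b'' r) = k₁)) :
    Tendsto
      (fun p : ℝ × ℝ =>
        Fbeta N a b (Function.update (Function.update x j p.1) ⟨j.val + 1, hj⟩ p.2)
          / (p.2 - p.1) ^ (-(1 / 8) : ℝ))
      (𝓝[{p : ℝ × ℝ |
          StrictMono (Function.update (Function.update x j p.1) ⟨j.val + 1, hj⟩ p.2)}] (ξ, ξ))
      (𝓝 (Fbeta (N - 1) a'' b'' fun i => x (skipTwo j i))) := by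
  classical
  obtain ⟨s₁, h₁⟩ := hk₁
  obtain ⟨s₂, h₂⟩ := hk₂
  set j' : Fin (2 * N) := ⟨j.val + 1, hj⟩ with hj'
  have hjj' : j ≠ j' := fun h => by simpa [hj'] using congrArg Fin.val h
  have hval (i : Fin (2 * N)) (h : i ≠ j) (h' : i ≠ j') : i.val ≠ j.val ∧ i.val ≠ j.val + 1 :=
    ⟨fun e => h (Fin.ext e), fun e => h' (Fin.ext e)⟩
  obtain ⟨ha, hb, hab⟩ := hβ.endpoints
  obtain ⟨ha'', hb'', hab''⟩ := hβ''.endpoints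
  have hs : s₂ ≠ s₁ := by
    rintro rfl
    have hlt := hβ.2.2.1 s₂
    rcases h₁ with ⟨e₁, e₁'⟩ | ⟨e₁, e₁'⟩ <;> rcases h₂ with ⟨e₂, e₂'⟩ | ⟨e₂, e₂'⟩
    · exact hjj' (e₁.symm.trans e₂)
    · exact hnot ⟨s₂, e₁, by rw [e₂']⟩
    · rw [e₂, e₁', Fin.lt_def] at hlt
      simp [hj'] at hlt
    · exact hjj' (e₁'.symm.trans e₂')
  have hk₁j : k₁ ≠ j ∧ k₁ ≠ j' := by grind [Function.Injective]
  have hk₂j : k₂ ≠ j ∧ k₂ ≠ j' := by grind [Function.Injective]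
  have hk : k₁ ≠ k₂ := by grind [Function.Injective]
  have hxlt (i i' : Fin (2 * N)) (h : i ≠ j ∧ i ≠ j') (h' : i' ≠ j ∧ i' ≠ j') (hii : i ≠ i') :
      x i ≠ x i' := by
    have e := hval i h.1 h.2
    have e' := hval i' h'.1 h'.2
    rcases lt_or_gt_of_ne hii with hlt | hlt
    · exact (hx i i' hlt e.1 e.2 e'.1 e'.2).ne
    · exact (hx i' i hlt e'.1 e'.2 e.1 e.2).ne'
  have hxξ (i : Fin (2 * N)) (h : i ≠ j ∧ i ≠ j') : x i ≠ ξ := by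
    have e := hval i h.1 h.2
    rcases lt_or_gt_of_ne e.1 with hlt | hlt
    · exact (hlo i hlt).ne
    · exact (hhi i (by omega)).ne'
  let κ := {t : {t : Fin N // t ≠ s₁} // t ≠ ⟨s₂, hs⟩}
  have hu (u : κ) : u.1.1 ≠ s₁ ∧ u.1.1 ≠ s₂ := ⟨u.1.2, fun h => u.2 (Subtype.ext h)⟩
  have hau (u : κ) : (a u.1.1 ≠ j ∧ a u.1.1 ≠ j') ∧ a u.1.1 ≠ k₁ ∧ a u.1.1 ≠ k₂ := by
    have := hu u
    grind [Function.Injective]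
  have hbu (u : κ) : (b u.1.1 ≠ j ∧ b u.1.1 ≠ j') ∧ b u.1.1 ≠ k₁ ∧ b u.1.1 ≠ k₂ := by
    have := hu u
    grind [Function.Injective]
  let e : Option (Option κ) ≃ Fin N :=
    (Equiv.optionSubtypeNe (⟨s₂, hs⟩ : {t : Fin N // t ≠ s₁})).optionCongr.trans
      (Equiv.optionSubtypeNe s₁)
  let c : κ → ℝ := fun u => x (a u.1.1)
  let d : κ → ℝ := fun u => x (b u.1.1)
  have hF (y z : ℝ) : Fbeta N a b (Function.update (Function.update x j y) j' z) =
      linkFun (consTwo (x k₁) z c) (consTwo y (x k₂) d) := by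
    have hX (i : Fin (2 * N)) (h : i ≠ j ∧ i ≠ j') :
        Function.update (Function.update x j y) j' z i = x i := by
      rw [Function.update_of_ne h.2, Function.update_of_ne h.1]
    have hXj : Function.update (Function.update x j y) j' z j = y := by
      rw [Function.update_of_ne hjj', Function.update_self]
    have hXj' : Function.update (Function.update x j y) j' z j' = z := Function.update_self ..
    rw [Fbeta_eq_linkFun]
    refine (linkFun_eq_of_equiv e _ _ _ _ fun o => ?_).symm
    rcases o with _ | _ | u
    · have he : e none = s₁ := by simp [e]
      rw [he]
      rcases h₁ with ⟨h, h'⟩ | ⟨h, h'⟩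
      · exact Or.inr (by rw [h, h', hXj, hX _ hk₁j]; exact ⟨rfl, rfl⟩)
      · exact Or.inl (by rw [h, h', hXj, hX _ hk₁j]; exact ⟨rfl, rfl⟩)
    · have he : e (some none) = s₂ := by simp [e]
      rw [he]
      rcases h₂ with ⟨h, h'⟩ | ⟨h, h'⟩
      · exact Or.inl (by rw [h, h', hXj', hX _ hk₂j]; exact ⟨rfl, rfl⟩)
      · exact Or.inr (by rw [h, h', hXj', hX _ hk₂j]; exact ⟨rfl, rfl⟩)
    · have he : e (some (some u)) = u.1.1 := by simp [e]
      rw [he]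
      exact Or.inl (by rw [hX _ (hau u).1, hX _ (hbu u).1]; exact ⟨rfl, rfl⟩)
  have hsome : ∀ r, ∃ o : Option κ,
      (∀ u, o = some u → skipTwo j (a'' r) = a u.1.1 ∧ skipTwo j (b'' r) = b u.1.1) ∧
      (o = none → (skipTwo j (a'' r) = k₁ ∧ skipTwo j (b'' r) = k₂) ∨
        (skipTwo j (a'' r) = k₂ ∧ skipTwo j (b'' r) = k₁)) := by
    intro r
    rcases hcorr r with ⟨s, hsa, hsb⟩ | h
    · have hA := skipTwo_ne j (a'' r)
      have hB := skipTwo_ne j (b'' r)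
      rw [hsa] at hA
      rw [hsb] at hB
      have hne₁ : s ≠ s₁ := by
        rintro rfl
        rcases h₁ with ⟨h, -⟩ | ⟨-, h⟩
        · exact hA.1 (congrArg Fin.val h)
        · exact hB.1 (congrArg Fin.val h)
      have hne₂ : s ≠ s₂ := by
        rintro rfl
        rcases h₂ with ⟨h, -⟩ | ⟨-, h⟩
        · exact hA.2 (congrArg Fin.val h)
        · exact hB.2 (congrArg Fin.val h)
      refine ⟨some ⟨⟨s, hne₁⟩, fun h => hne₂ (congrArg Subtype.val h)⟩, fun u h => ?_, by simp⟩
      obtain rfl := Option.some_injective _ h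
      exact ⟨hsa, hsb⟩
    · exact ⟨none, by simp, fun _ => h⟩
  choose f hf hf' using hsome
  have hskip := skipTwo_injective j
  have hfinj : Function.Injective f := by
    intro r r' hrr
    cases ho : f r with
    | some u =>
      exact ha'' (hskip (((hf r u ho).1).trans (hf r' u (hrr ▸ ho)).1.symm))
    | none =>
      rcases hf' r ho with ⟨h, h'⟩ | ⟨h, h'⟩ <;>
        rcases hf' r' (hrr ▸ ho) with ⟨g, g'⟩ | ⟨g, g'⟩
      · exact ha'' (hskip (h.trans g.symm))
      · exact absurd (hskip (h.trans g'.symm)) (hab'' _ _)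
      · exact absurd (hskip (h.trans g'.symm)) (hab'' _ _)
      · exact ha'' (hskip (h.trans g.symm))
  have hcard : Fintype.card (Fin (N - 1)) = Fintype.card (Option κ) := by
    have := Fintype.card_congr e
    rw [Fintype.card_option, Fintype.card_fin] at this
    rw [Fintype.card_fin]
    omega
  let e'' := Equiv.ofBijective f ((Fintype.bijective_iff_injective_and_card f).2 ⟨hfinj, hcard⟩)
  have hlim : (Fbeta (N - 1) a'' b'' fun i => x (skipTwo j i)) =
      linkFun (consOne (x k₁) c) (consOne (x k₂) d) := by
    rw [Fbeta_eq_linkFun]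
    refine linkFun_eq_of_equiv e'' _ _ _ _ fun r => ?_
    rw [show e'' r = f r from rfl]
    cases ho : f r with
    | some u => exact Or.inl (by rw [(hf r u ho).1, (hf r u ho).2]; exact ⟨rfl, rfl⟩)
    | none =>
      rcases hf' r ho with ⟨h, h'⟩ | ⟨h, h'⟩
      · exact Or.inl (by rw [h, h']; exact ⟨rfl, rfl⟩)
      · exact Or.inr (by rw [h, h']; exact ⟨rfl, rfl⟩)
  simp only [hF]
  rw [hlim]
  refine (tendsto_linkFun_consTwo (hxξ k₁ hk₁j) (hxξ k₂ hk₂j) (hxlt k₁ k₂ hk₁j hk₂j hk)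
    (fun u => hxξ _ (hau u).1) (fun u => hxξ _ (hbu u).1)
    (fun u => hxlt _ _ (hau u).1 hk₁j (hau u).2.1) (fun u => hxlt _ _ (hbu u).1 hk₁j (hbu u).2.1)
    (fun u => hxlt _ _ (hau u).1 hk₂j (hau u).2.2)
    (fun u => hxlt _ _ (hbu u).1 hk₂j (hbu u).2.2)).mono_left (nhdsWithin_mono _ fun p hp => ?_)
  have hlt : j < j' := by simp [Fin.lt_def, hj']
  simpa [Function.update_of_ne hjj'] using hp hlt
end
end

section
/- For every N ≥ 1 and every x = (x_1,…,x_{2N}) ∈ 𝔛_{2N}, one has Y^{(N)}(x_1,…,x_{2N}) ≥ 1. -/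
noncomputable section

/-- The index of `x_{2r-1}` (1-indexed), i.e. `2r` (0-indexed). -/
def idxA (N : ℕ) (r : Fin N) : Fin (2 * N) := ⟨2 * r.val, by have := r.isLt; omega⟩

/-- The index of `x_{2r}` (1-indexed), i.e. `2r+1` (0-indexed). -/
def idxB (N : ℕ) (r : Fin N) : Fin (2 * N) := ⟨2 * r.val + 1, by have := r.isLt; omega⟩

/-- The quantity `Y^{(N)}(x) = (∑_{σ∈{±1}^N} ∏_{s<t} χ(x_{2s-1},x_{2t-1},x_{2t},x_{2s})^{σ_sσ_t/4})^{1/2}`. -/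
def Ynn (N : ℕ) (x : Fin (2 * N) → ℝ) : ℝ :=
  (∑ σ : Fin N → Bool, ∏ s : Fin N, ∏ t : Fin N,
      if s < t then
        crossRatioR (x (idxA N s)) (x (idxA N t)) (x (idxB N t)) (x (idxB N s))
          ^ (sgn (σ s) * sgn (σ t) / 4)
      else 1) ^ ((1 : ℝ) / 2)

theorem sgn_not (b : Bool) : sgn (!b) = -sgn b := by
  cases b <;> simp [sgn]

theorem sum_sgn_mul_sgn_eq_zero {ι : Type*} [Fintype ι] [DecidableEq ι] {s t : ι} (hst : s ≠ t) :
    ∑ σ : ι → Bool, sgn (σ s) * sgn (σ t) = 0 := by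
  have flip_involutive : Function.Involutive
      (fun σ : ι → Bool => Function.update σ s (!σ s)) := by
    intro σ
    simp
  have h := Equiv.sum_comp flip_involutive.toPerm (fun σ => sgn (σ s) * sgn (σ t))
  simp only [Function.Involutive.coe_toPerm, Function.update_self,
    Function.update_of_ne hst.symm, sgn_not, neg_mul, Finset.sum_neg_distrib] at h
  linarith

theorem crossRatioR_pos {y₁ y₂ y₃ y₄ : ℝ} (h₁₂ : y₁ ≠ y₂) (h₃₄ : y₃ ≠ y₄) (h₁₃ : y₁ ≠ y₃)
    (h₂₄ : y₂ ≠ y₄) : 0 < crossRatioR y₁ y₂ y₃ y₄ :=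
  div_pos (mul_pos (abs_pos.2 (sub_ne_zero.2 h₁₂.symm)) (abs_pos.2 (sub_ne_zero.2 h₃₄.symm)))
    (mul_pos (abs_pos.2 (sub_ne_zero.2 h₁₃.symm)) (abs_pos.2 (sub_ne_zero.2 h₂₄.symm)))

/-- The partition function of an Ising model with pair weights `c s t > 0` is at least the number
of configurations. -/
theorem card_le_sum_prod_rpow {ι : Type*} [Fintype ι] [LinearOrder ι] (c : ι → ι → ℝ)
    (hc : ∀ s t, s < t → 0 < c s t) :
    (Fintype.card (ι → Bool) : ℝ) ≤ ∑ σ : ι → Bool, ∏ s, ∏ t,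
      if s < t then c s t ^ (sgn (σ s) * sgn (σ t) / 4) else 1 := by
  let energy (σ : ι → Bool) : ℝ :=
    ∑ s, ∑ t, if s < t then Real.log (c s t) / 4 * (sgn (σ s) * sgn (σ t)) else 0
  have prod_eq (σ : ι → Bool) : (∏ s, ∏ t,
      if s < t then c s t ^ (sgn (σ s) * sgn (σ t) / 4) else 1) = Real.exp (energy σ) := by
    simp only [energy, Real.exp_sum]
    refine Finset.prod_congr rfl fun s _ => Finset.prod_congr rfl fun t _ => ?_
    split_ifs with h
    · rw [Real.rpow_def_of_pos (hc s t h)]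
      ring_nf
    · simp
  have sum_energy : ∑ σ, energy σ = 0 := by
    simp only [energy]
    rw [Finset.sum_comm]
    refine Finset.sum_eq_zero fun s _ => ?_
    rw [Finset.sum_comm]
    refine Finset.sum_eq_zero fun t _ => ?_
    split_ifs with h
    · rw [← Finset.mul_sum, sum_sgn_mul_sgn_eq_zero h.ne, mul_zero]
    · simp
  calc (Fintype.card (ι → Bool) : ℝ) = ∑ σ : ι → Bool, (energy σ + 1) := by
        rw [Finset.sum_add_distrib, sum_energy]
        simp
    _ ≤ _ := Finset.sum_le_sum fun σ _ => (prod_eq σ).symm ▸ Real.add_one_le_exp (energy σ)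

/-- for `N ≥ 1` and `x ∈ 𝔛_{2N}`, `Y^{(N)}(x) ≥ 1`. -/
theorem Ynn_ge_one (N : ℕ) (hN : 1 ≤ N) (x : Fin (2 * N) → ℝ) (hx : StrictMono x) :
    1 ≤ Ynn N x := by
  refine Real.one_le_rpow (le_trans ?_ (card_le_sum_prod_rpow _ fun s t hst => ?_)) (by norm_num)
  · exact_mod_cast Fintype.card_pos
  · have hst' : s.val < t.val := hst
    apply crossRatioR_pos <;> refine hx.injective.ne fun h => ?_ <;>
      simp only [idxA, idxB, Fin.mk.injEq] at h <;> omega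
end
end
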